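/- arXiv:2306.00350 — 2 statements merged into one kernel-verified Lean document; each statement's English description precedes it below -/
import Mathlib

section
/- Theorem 1, modification-R case: Fix ε > 0. If π̄_R is a Nash distribution with modification-R with parameter ε, then the score ȳ_* = w(π̄_R) satisfies σ(ȳ_*) = π̄_R, and hence ȳ_* is a rest point of the IESL dynamic, i.e. w(σ(ȳ_*)) = ȳ_*. -/
open scoped Classical BigOperators

noncomputable section

/-- An `n`-player finite-horizon imperfect-information game with simultaneous moves
(a finite-horizon POSG).  `Obs` is the joint-observation kernel, `O0` the initial
joint-observation kernel, `Tr` the transition kernel, `R` the reward functions. -/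
structure POSG where
  n : ℕ
  n_pos : 0 < n
  S : Type
  [S_fin : Fintype S]
  [S_ne : Nonempty S]
  Z : Fin n → Type
  [Z_fin : ∀ i, Fintype (Z i)]
  [Z_ne : ∀ i, Nonempty (Z i)]
  A : Type
  [A_fin : Fintype A]
  [A_ne : Nonempty A]
  T : ℕ
  T_pos : 1 ≤ T
  γ : ℝ
  γ_pos : 0 < γ
  γ_le_one : γ ≤ 1
  ρ : S → ℝ
  ρ_nonneg : ∀ s, 0 ≤ ρ s
  ρ_sum : ∑ s, ρ s = 1
  O0 : S → (∀ i, Z i) → ℝ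
  O0_nonneg : ∀ s z, 0 ≤ O0 s z
  O0_sum : ∀ s, ∑ z, O0 s z = 1
  Tr : S → (Fin n → A) → S → ℝ
  Tr_nonneg : ∀ s a s', 0 ≤ Tr s a s'
  Tr_sum : ∀ s a, ∑ s', Tr s a s' = 1
  Obs : S → (Fin n → A) → S → (∀ i, Z i) → ℝ
  Obs_nonneg : ∀ s a s' z, 0 ≤ Obs s a s' z
  Obs_sum : ∀ s a s', ∑ z, Obs s a s' z = 1
  R : Fin n → S → (Fin n → A) → S → ℝ

attribute [instance] POSG.S_fin POSG.S_ne POSG.Z_fin POSG.Z_ne POSG.A_fin POSG.A_ne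

/-- Softmax choice map with regularization parameter `ε`. -/
def softmax {α : Type*} [Fintype α] (ε : ℝ) (y : α → ℝ) (a : α) : ℝ :=
  Real.exp (y a / ε) / ∑ b, Real.exp (y b / ε)

/-- Negative Gibbs entropy `H(p) = ∑ₐ p a * log (p a)` (with `0 * log 0 = 0`). -/
def negEnt {α : Type*} [Fintype α] (p : α → ℝ) : ℝ := ∑ a, p a * Real.log (p a)

namespace POSG

variable (G : POSG)

/-- Joint actions. -/
abbrev JointAct := Fin G.n → G.A

/-- Tuples of observations, one for each player. -/
abbrev ObsTuple := ∀ i, G.Z i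

/-- Global histories at step `t`:
`h_t = (s_0, z̄_0, ā_0, …, ā_{t-1}, s_t, z̄_t)`. -/
abbrev Hist (t : ℕ) := (Fin (t + 1) → G.S) × (Fin (t + 1) → G.ObsTuple) × (Fin t → G.JointAct)

/-- Local trajectories (information sets) of player `i` at step `t`:
`x_t^i = (z_0^i, a_0^i, …, a_{t-1}^i, z_t^i)`. -/
abbrev LocTraj (i : Fin G.n) (t : ℕ) := (Fin (t + 1) → G.Z i) × (Fin t → G.A)

/-- Reduction of a global history to player `i`'s local trajectory;
`h ∈ x` is expressed as `G.red i h = x`. -/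
def red (i : Fin G.n) {t : ℕ} (h : G.Hist t) : G.LocTraj i t :=
  (fun k => h.2.1 k i, fun k => h.2.2 k i)

/-- A policy of player `i` assigns to every local trajectory a vector of action weights. -/
abbrev Policy (i : Fin G.n) := ∀ t : Fin G.T, G.LocTraj i t.1 → G.A → ℝ

/-- Joint policies. -/
abbrev JointPolicy := ∀ i : Fin G.n, G.Policy i

/-- The score space: one real number for each information-set–action pair. -/
abbrev Score := ∀ i : Fin G.n, ∀ t : Fin G.T, G.LocTraj i t.1 → G.A → ℝ

/-- `p` is a genuine (probability-simplex valued) policy. -/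
def IsPolicy {i : Fin G.n} (p : G.Policy i) : Prop :=
  (∀ t x a, 0 ≤ p t x a) ∧ (∀ t x, ∑ a, p t x a = 1)

def IsJointPolicy (π : G.JointPolicy) : Prop := ∀ i, G.IsPolicy (π i)

/-- Fully mixed joint policy: all actions have positive probability everywhere. -/
def FullyMixed (π : G.JointPolicy) : Prop := ∀ i t x a, 0 < π i t x a

/-- Current (last) state of a history. -/
def lastState {t : ℕ} (h : G.Hist t) : G.S := h.1 (Fin.last t)

/-- Probability of a joint action at a history under a joint policy. -/
def polProb (π : G.JointPolicy) {t : ℕ} (h : G.Hist t) (a : G.JointAct) : ℝ :=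
  if ht : t < G.T then ∏ i, π i ⟨t, ht⟩ (G.red i h) (a i) else 0

/-- Extension of a history by one step. -/
def extend {t : ℕ} (h : G.Hist t) (a : G.JointAct) (s' : G.S) (z' : G.ObsTuple) :
    G.Hist (t + 1) :=
  (Fin.snoc h.1 s', Fin.snoc h.2.1 z', Fin.snoc h.2.2 a)

/-- The one-step-shorter prefix of a history. -/
def front {t : ℕ} (h : G.Hist (t + 1)) : G.Hist t :=
  (fun k => h.1 k.castSucc, fun k => h.2.1 k.castSucc, fun k => h.2.2 k.castSucc)

/-- `Pr(h_t | π̄)`: the product of the initial, transition, observation and policy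
probabilities along the history. -/
def histProb (π : G.JointPolicy) : (t : ℕ) → G.Hist t → ℝ
  | 0, h => G.ρ (h.1 0) * G.O0 (h.1 0) (h.2.1 0)
  | (t + 1), h =>
      histProb π t (G.front h) * G.polProb π (G.front h) (h.2.2 (Fin.last t)) *
        G.Tr (G.lastState (G.front h)) (h.2.2 (Fin.last t)) (G.lastState h) *
        G.Obs (G.lastState (G.front h)) (h.2.2 (Fin.last t)) (G.lastState h)
          (h.2.1 (Fin.last (t + 1)))

/-- Auxiliary (fuel-indexed) value recursion. -/
def valAux (π : G.JointPolicy) (i : Fin G.n) : ℕ → (t : ℕ) → G.Hist t → ℝ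
  | 0, _, _ => 0
  | (fuel + 1), t, h =>
      if t < G.T then
        ∑ a : G.JointAct, ∑ s' : G.S, ∑ z' : G.ObsTuple,
          G.polProb π h a * G.Tr (G.lastState h) a s' * G.Obs (G.lastState h) a s' z' *
            (G.R i (G.lastState h) a s' + G.γ * valAux π i fuel (t + 1) (G.extend h a s' z'))
      else 0

/-- `V^i_π̄(h_t) = E[ ∑_{k=t}^{T-1} γ^{k-t} R^i(s_k, ā_k, s_{k+1}) | h_t, π̄ ]`. -/
def V (π : G.JointPolicy) (i : Fin G.n) {t : ℕ} (h : G.Hist t) : ℝ :=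
  G.valAux π i (G.T - t) t h

/-- `Q^i_π̄(h_t, a^i)`: expected value conditioned on player `i` playing `a^i` at `h_t`
while the other players follow `π̄`. -/
def Q (π : G.JointPolicy) (i : Fin G.n) {t : ℕ} (h : G.Hist t) (ai : G.A) : ℝ :=
  if ht : t < G.T then
    ∑ a : G.JointAct, ∑ s' : G.S, ∑ z' : G.ObsTuple,
      (if a i = ai then ∏ j ∈ Finset.univ.erase i, π j ⟨t, ht⟩ (G.red j h) (a j) else 0) *
        G.Tr (G.lastState h) a s' * G.Obs (G.lastState h) a s' z' *
        (G.R i (G.lastState h) a s' + G.γ * G.V π i (G.extend h a s' z'))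
  else 0

/-- The advantage function `A^i_π̄(h_t, a^i) = Q^i_π̄(h_t, a^i) − V^i_π̄(h_t)`. -/
def Adv (π : G.JointPolicy) (i : Fin G.n) {t : ℕ} (h : G.Hist t) (ai : G.A) : ℝ :=
  G.Q π i h ai - G.V π i h

/-- The initial history determined by `s_0` and `z̄_0`. -/
def hist0 (s : G.S) (z : G.ObsTuple) : G.Hist 0 :=
  (fun _ => s, fun _ => z, fun k => k.elim0)

/-- The utility `u^i(π̄) = E_{h_0}[ V^i_π̄(h_0) ]`. -/
def u (π : G.JointPolicy) (i : Fin G.n) : ℝ :=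
  ∑ s : G.S, ∑ z : G.ObsTuple, G.ρ s * G.O0 s z * G.V π i (G.hist0 s z)

/-- `∑_{h_t ∈ x_t^i} Pr(h_t | π̄)`: reaching probability of an information set. -/
def reach (π : G.JointPolicy) (i : Fin G.n) {t : ℕ} (x : G.LocTraj i t) : ℝ :=
  ∑ h : G.Hist t, if G.red i h = x then G.histProb π t h else 0

/-- `∑_{h_t ∈ x_t^i} Pr(h_t | π̄) A^i_π̄(h_t, a)`. -/
def advW (π : G.JointPolicy) (i : Fin G.n) {t : ℕ} (x : G.LocTraj i t) (a : G.A) : ℝ :=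
  ∑ h : G.Hist t, if G.red i h = x then G.histProb π t h * G.Adv π i h a else 0

/-- The local advantage map `w`. -/
def w (π : G.JointPolicy) : G.Score :=
  fun i t x a => G.advW π i x a / G.reach π i x

/-- The regularized choice map `σ` (softmax with parameter `ε`). -/
def choice (ε : ℝ) (y : G.Score) : G.JointPolicy :=
  fun i t x a => softmax ε (y i t x) a

/-- Assumption: every local trajectory contains some history with positive probability
under fully mixed joint policies. -/
def ReachPos : Prop :=
  ∀ π : G.JointPolicy, G.IsJointPolicy π → G.FullyMixed π →
    ∀ (i : Fin G.n) (t : Fin G.T) (x : G.LocTraj i t.1), 0 < G.reach π i x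

/-- The discounted entropy-regularization term
`ε ∑_{t<T} γ^t ∑_{x_t^i} H(p(x_t^i)) ∑_{h_t ∈ x_t^i} Pr(h_t | π_reach)`. -/
def entReg (ε : ℝ) {i : Fin G.n} (p : G.Policy i) (πreach : G.JointPolicy) : ℝ :=
  ε * ∑ t : Fin G.T, G.γ ^ (t : ℕ) *
    ∑ x : G.LocTraj i t.1, negEnt (p t x) * G.reach πreach i x

/-- Nash distribution with modification-L (parameter `ε`). -/
def NashDistL (ε : ℝ) (πL : G.JointPolicy) : Prop :=
  ∀ (i : Fin G.n) (p : G.Policy i), G.IsPolicy p →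
    G.u πL i - G.entReg ε (πL i) πL ≥
      G.u (Function.update πL i p) i - G.entReg ε p πL

/-- Nash distribution with modification-R (parameter `ε`). -/
def NashDistR (ε : ℝ) (πR : G.JointPolicy) : Prop :=
  ∀ (i : Fin G.n) (p : G.Policy i), G.IsPolicy p →
    G.u πR i - G.entReg ε (πR i) (Function.update πR i p) ≥
      G.u (Function.update πR i p) i - G.entReg ε p (Function.update πR i p)

end POSG

namespace POSG

variable (G : POSG)

theorem aux_V_ge (π : G.JointPolicy) (i : Fin G.n) {t : ℕ} (h : G.Hist t) (ht : G.T ≤ t) :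
    G.V π i h = 0 := by
  unfold V
  rw [Nat.sub_eq_zero_of_le ht]
  rfl

theorem aux_V_lt (π : G.JointPolicy) (i : Fin G.n) {t : ℕ} (h : G.Hist t) (ht : t < G.T) :
    G.V π i h = ∑ a : G.JointAct, ∑ s' : G.S, ∑ z' : G.ObsTuple,
          G.polProb π h a * G.Tr (G.lastState h) a s' * G.Obs (G.lastState h) a s' z' *
            (G.R i (G.lastState h) a s' + G.γ * G.V π i (G.extend h a s' z')) := by
  unfold V
  have : G.T - t = (G.T - (t + 1)) + 1 := by omega
  rw [this, valAux, if_pos ht]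

theorem aux_polProb (π π' : G.JointPolicy) (i : Fin G.n) (hag : ∀ j, j ≠ i → π' j = π j)
    {t : ℕ} (ht : t < G.T) (h : G.Hist t) (a : G.JointAct) :
    G.polProb π' h a = π' i ⟨t, ht⟩ (G.red i h) (a i) *
      ∏ j ∈ Finset.univ.erase i, π j ⟨t, ht⟩ (G.red j h) (a j) := by
  unfold polProb
  rw [dif_pos ht, ← Finset.mul_prod_erase Finset.univ _ (Finset.mem_univ i)]
  congr 1
  refine Finset.prod_congr rfl fun j hj => ?_
  rw [hag j (Finset.ne_of_mem_erase hj)]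

theorem aux_sumQ (π π' : G.JointPolicy) (i : Fin G.n) (hag : ∀ j, j ≠ i → π' j = π j)
    {t : ℕ} (ht : t < G.T) (h : G.Hist t) :
    ∑ ai, π' i ⟨t, ht⟩ (G.red i h) ai * G.Q π i h ai =
      ∑ a : G.JointAct, ∑ s' : G.S, ∑ z' : G.ObsTuple,
          G.polProb π' h a * G.Tr (G.lastState h) a s' * G.Obs (G.lastState h) a s' z' *
            (G.R i (G.lastState h) a s' + G.γ * G.V π i (G.extend h a s' z')) := by
  unfold Q
  simp only [dif_pos ht, Finset.mul_sum]
  rw [Finset.sum_comm]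
  refine Finset.sum_congr rfl fun a _ => ?_
  rw [Finset.sum_comm]
  refine Finset.sum_congr rfl fun s _ => ?_
  rw [Finset.sum_comm]
  refine Finset.sum_congr rfl fun z _ => ?_
  rw [Finset.sum_eq_single (a i)]
  · rw [if_pos rfl, G.aux_polProb π π' i hag ht]; ring
  · intro b _ hb
    rw [if_neg (Ne.symm hb)]; ring
  · intro hh; exact absurd (Finset.mem_univ _) hh

theorem aux_polProb_sum (π : G.JointPolicy) (hπ : G.IsJointPolicy π)
    {t : ℕ} (ht : t < G.T) (h : G.Hist t) : ∑ a, G.polProb π h a = 1 := by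
  unfold polProb
  simp only [dif_pos ht]
  rw [← Fintype.piFinset_univ, ← Finset.prod_univ_sum]
  exact Finset.prod_eq_one fun j _ => (hπ j).2 _ _

theorem aux_sumAdv (π π' : G.JointPolicy) (hπ' : G.IsJointPolicy π') (i : Fin G.n)
    {t : ℕ} (ht : t < G.T) (h : G.Hist t) :
    ∑ ai, π' i ⟨t, ht⟩ (G.red i h) ai * G.Adv π i h ai =
      ∑ ai, π' i ⟨t, ht⟩ (G.red i h) ai * G.Q π i h ai - G.V π i h := by
  unfold Adv
  simp only [mul_sub, Finset.sum_sub_distrib, ← Finset.sum_mul]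
  rw [(hπ' i).2, one_mul]

theorem aux_sumAdv_self (π : G.JointPolicy) (hπ : G.IsJointPolicy π) (i : Fin G.n)
    {t : ℕ} (ht : t < G.T) (h : G.Hist t) :
    ∑ ai, π i ⟨t, ht⟩ (G.red i h) ai * G.Adv π i h ai = 0 := by
  rw [G.aux_sumAdv π π hπ i ht, G.aux_sumQ π π i (fun _ _ => rfl) ht, ← G.aux_V_lt π i h ht,
    sub_self]

theorem aux_V_diff (π π' : G.JointPolicy) (hπ' : G.IsJointPolicy π') (i : Fin G.n)
    (hag : ∀ j, j ≠ i → π' j = π j) {t : ℕ} (ht : t < G.T) (h : G.Hist t) :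
    G.V π' i h - G.V π i h = ∑ ai, π' i ⟨t, ht⟩ (G.red i h) ai * G.Adv π i h ai +
      G.γ * ∑ a : G.JointAct, ∑ s' : G.S, ∑ z' : G.ObsTuple,
          G.polProb π' h a * G.Tr (G.lastState h) a s' * G.Obs (G.lastState h) a s' z' *
            (G.V π' i (G.extend h a s' z') - G.V π i (G.extend h a s' z')) := by
  rw [G.aux_sumAdv π π' hπ' i ht, G.aux_sumQ π π' i hag ht, G.aux_V_lt π' i h ht]
  rw [← sub_eq_zero]
  simp only [Finset.mul_sum]
  rw [sub_add_eq_add_sub, sub_sub_sub_cancel_right]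
  rw [sub_eq_zero, ← Finset.sum_add_distrib]
  refine Finset.sum_congr rfl fun a _ => ?_
  rw [← Finset.sum_add_distrib]
  refine Finset.sum_congr rfl fun s _ => ?_
  rw [← Finset.sum_add_distrib]
  refine Finset.sum_congr rfl fun z _ => ?_
  ring

def auxEquiv (t : ℕ) : (G.Hist t × G.JointAct × G.S × G.ObsTuple) ≃ G.Hist (t + 1) where
  toFun q := G.extend q.1 q.2.1 q.2.2.1 q.2.2.2
  invFun h := (G.front h, h.2.2 (Fin.last t), G.lastState h, h.2.1 (Fin.last (t + 1)))
  left_inv := by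
    rintro ⟨⟨h1, h2, h3⟩, a, s, z⟩
    simp [extend, front, lastState]
  right_inv := by
    rintro ⟨h1, h2, h3⟩
    refine Prod.ext ?_ (Prod.ext ?_ ?_)
    · exact Fin.snoc_init_self h1
    · exact Fin.snoc_init_self h2
    · exact Fin.snoc_init_self h3

theorem aux_sum_hist (t : ℕ) (f : G.Hist (t + 1) → ℝ) :
    ∑ h, f h = ∑ h : G.Hist t, ∑ a : G.JointAct, ∑ s' : G.S, ∑ z' : G.ObsTuple,
      f (G.extend h a s' z') := by
  rw [← (G.auxEquiv t).sum_comp f]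
  rw [Fintype.sum_prod_type]
  refine Finset.sum_congr rfl fun h _ => ?_
  rw [Fintype.sum_prod_type]
  refine Finset.sum_congr rfl fun a _ => ?_
  rw [Fintype.sum_prod_type]
  rfl

theorem aux_histProb_extend (π : G.JointPolicy) {t : ℕ} (h : G.Hist t) (a : G.JointAct)
    (s : G.S) (z : G.ObsTuple) :
    G.histProb π (t + 1) (G.extend h a s z) = G.histProb π t h * G.polProb π h a *
      G.Tr (G.lastState h) a s * G.Obs (G.lastState h) a s z := by
  have h1 : G.front (G.extend h a s z) = h := congrArg Prod.fst ((G.auxEquiv t).left_inv (h, a, s, z))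
  have h2 : G.lastState (G.extend h a s z) = s := by simp [extend, lastState]
  rw [histProb, h1, h2]
  simp [extend]

def auxD (π π' : G.JointPolicy) (i : Fin G.n) (t : ℕ) : ℝ :=
  ∑ h : G.Hist t, G.histProb π' t h * (G.V π' i h - G.V π i h)

def auxg (π π' : G.JointPolicy) (i : Fin G.n) (t : ℕ) : ℝ :=
  if ht : t < G.T then
    ∑ h : G.Hist t, G.histProb π' t h *
      ∑ ai, π' i ⟨t, ht⟩ (G.red i h) ai * G.Adv π i h ai
  else 0

theorem aux_D_step (π π' : G.JointPolicy) (hπ' : G.IsJointPolicy π') (i : Fin G.n)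
    (hag : ∀ j, j ≠ i → π' j = π j) {t : ℕ} (ht : t < G.T) :
    G.auxD π π' i t = G.auxg π π' i t + G.γ * G.auxD π π' i (t + 1) := by
  unfold auxD auxg
  rw [dif_pos ht, G.aux_sum_hist t, Finset.mul_sum, ← Finset.sum_add_distrib]
  refine Finset.sum_congr rfl fun h _ => ?_
  rw [G.aux_V_diff π π' hπ' i hag ht, mul_add]
  congr 1
  rw [mul_left_comm]
  congr 1
  simp only [Finset.mul_sum, G.aux_histProb_extend]
  refine Finset.sum_congr rfl fun a _ => Finset.sum_congr rfl fun s _ =>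
    Finset.sum_congr rfl fun z _ => ?_
  ring

theorem aux_D_sum (π π' : G.JointPolicy) (hπ' : G.IsJointPolicy π') (i : Fin G.n)
    (hag : ∀ j, j ≠ i → π' j = π j) (m : ℕ) (hm : m ≤ G.T) :
    G.auxD π π' i 0 = ∑ k ∈ Finset.range m, G.γ ^ k * G.auxg π π' i k
      + G.γ ^ m * G.auxD π π' i m := by
  induction m with
  | zero => simp
  | succ m ih =>
    rw [ih (by omega), Finset.sum_range_succ, G.aux_D_step π π' hπ' i hag (by omega : m < G.T)]
    ring

def auxEquiv0 : (G.S × G.ObsTuple) ≃ G.Hist 0 where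
  toFun q := G.hist0 q.1 q.2
  invFun h := (h.1 0, h.2.1 0)
  left_inv := by rintro ⟨s, z⟩; rfl
  right_inv := by
    rintro ⟨h1, h2, h3⟩
    refine Prod.ext ?_ (Prod.ext ?_ ?_)
    · funext k; exact congrArg h1 (Subsingleton.elim (α := Fin 1) _ _)
    · funext k; exact congrArg h2 (Subsingleton.elim (α := Fin 1) _ _)
    · funext k; exact k.elim0

theorem aux_D_zero (π π' : G.JointPolicy) (i : Fin G.n) :
    G.auxD π π' i 0 = G.u π' i - G.u π i := by
  unfold auxD u
  rw [← G.auxEquiv0.sum_comp, Fintype.sum_prod_type, ← Finset.sum_sub_distrib]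
  refine Finset.sum_congr rfl fun s _ => ?_
  rw [← Finset.sum_sub_distrib]
  refine Finset.sum_congr rfl fun z _ => ?_
  rw [← mul_sub]
  rfl

theorem aux_u_diff (π π' : G.JointPolicy) (hπ' : G.IsJointPolicy π') (i : Fin G.n)
    (hag : ∀ j, j ≠ i → π' j = π j) :
    G.u π' i - G.u π i = ∑ k ∈ Finset.range G.T, G.γ ^ k * G.auxg π π' i k := by
  rw [← aux_D_zero, G.aux_D_sum π π' hπ' i hag G.T le_rfl]
  have : G.auxD π π' i G.T = 0 := by
    unfold auxD
    simp [G.aux_V_ge]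
  rw [this]; simp

theorem aux_histProb_congr (π π' : G.JointPolicy) (m : ℕ)
    (hag : ∀ j (k : Fin G.T), k.1 < m → π' j k = π j k) (h : G.Hist m) :
    G.histProb π' m h = G.histProb π m h := by
  induction m with
  | zero => rfl
  | succ m ih =>
    rw [histProb, histProb, ih (fun j k hk => hag j k (by omega))]
    have : ∀ a, G.polProb π' (G.front h) a = G.polProb π (G.front h) a := by
      intro a
      unfold polProb
      split_ifs with ht
      · exact Finset.prod_congr rfl fun j _ => by rw [hag j ⟨m, ht⟩ (Nat.lt_succ_self m)]
      · rfl
    rw [this]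

theorem aux_reach_congr (π π' : G.JointPolicy) (m : ℕ)
    (hag : ∀ j (k : Fin G.T), k.1 < m → π' j k = π j k) (i : Fin G.n) (x : G.LocTraj i m) :
    G.reach π' i x = G.reach π i x := by
  unfold reach
  simp only [G.aux_histProb_congr π π' m hag]

end POSG

theorem aux_gibbs {α : Type*} [Fintype α] [Nonempty α] (ε : ℝ) (hε : 0 < ε) (y p : α → ℝ)
    (hp0 : ∀ a, 0 ≤ p a) (hp1 : ∑ a, p a = 1) (hpy : ∑ a, p a * y a = 0)
    (hmax : ∑ a, softmax ε y a * y a - ε * (negEnt (softmax ε y) - negEnt p) ≤ 0) :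
    p = softmax ε y := by
  set Z := ∑ b, Real.exp (y b / ε) with hZ
  have hZpos : 0 < Z := Finset.sum_pos (fun _ _ => Real.exp_pos _) Finset.univ_nonempty
  set q := softmax ε y with hq
  have hqa : ∀ a, q a = Real.exp (y a / ε) / Z := fun a => rfl
  have hqpos : ∀ a, 0 < q a := fun a => div_pos (Real.exp_pos _) hZpos
  have hq1 : ∑ a, q a = 1 := by
    simp only [hqa, ← Finset.sum_div]; exact div_self hZpos.ne'
  have hlog : ∀ a, Real.log (q a) = y a / ε - Real.log Z := fun a => by
    rw [hqa, Real.log_div (Real.exp_pos _).ne' hZpos.ne', Real.log_exp]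
  have hHq : ε * negEnt q = ∑ a, q a * y a - ε * Real.log Z := by
    unfold negEnt
    have : ε * Real.log Z = ∑ a, q a * (ε * Real.log Z) := by
      rw [← Finset.sum_mul, hq1, one_mul]
    rw [this, Finset.mul_sum, ← Finset.sum_sub_distrib]
    refine Finset.sum_congr rfl fun a _ => ?_
    rw [hlog]; field_simp
  have hkey : negEnt p + Real.log Z ≤ 0 := by
    have : ε * (negEnt p + Real.log Z) ≤ 0 := by linarith
    exact nonpos_of_mul_nonpos_right this hε
  have hkl : ∑ a, q a * InformationTheory.klFun (p a / q a) = negEnt p + Real.log Z := by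
    have e : ∀ a, q a * InformationTheory.klFun (p a / q a)
        = p a * Real.log (p a) - p a * y a / ε + p a * Real.log Z + q a - p a := by
      intro a
      have hne := (hqpos a).ne'
      unfold InformationTheory.klFun
      by_cases h0 : p a = 0
      · simp [h0]
      · rw [Real.log_div h0 hne, hlog]
        have : q a * (p a / q a) = p a := by field_simp
        linear_combination (Real.log (p a) - (y a / ε - Real.log Z) - 1) * this
    simp only [e, Finset.sum_add_distrib, Finset.sum_sub_distrib, ← Finset.sum_div,
      ← Finset.sum_mul, hpy, hp1, hq1, negEnt]
    ring
  have hnn : ∀ a ∈ Finset.univ, 0 ≤ q a * InformationTheory.klFun (p a / q a) := fun a _ =>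
    mul_nonneg (hqpos a).le (InformationTheory.klFun_nonneg (div_nonneg (hp0 a) (hqpos a).le))
  have hz := (Finset.sum_eq_zero_iff_of_nonneg hnn).1
    (le_antisymm (hkl ▸ hkey) (Finset.sum_nonneg hnn))
  funext a
  have h1 := (mul_eq_zero.1 (hz a (Finset.mem_univ a))).resolve_left (hqpos a).ne'
  rw [InformationTheory.klFun_eq_zero_iff (div_nonneg (hp0 a) (hqpos a).le)] at h1
  exact (div_eq_one_iff_eq (hqpos a).ne').1 h1

theorem aux_softmax_pos {α : Type*} [Fintype α] [Nonempty α] (ε : ℝ) (y : α → ℝ) (a : α) :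
    0 < softmax ε y a :=
  div_pos (Real.exp_pos _) (Finset.sum_pos (fun _ _ => Real.exp_pos _) Finset.univ_nonempty)

theorem aux_softmax_sum {α : Type*} [Fintype α] [Nonempty α] (ε : ℝ) (y : α → ℝ) :
    ∑ a, softmax ε y a = 1 := by
  unfold softmax
  rw [← Finset.sum_div]
  exact div_self (Finset.sum_pos (fun _ _ => Real.exp_pos _) Finset.univ_nonempty).ne'

namespace POSG

variable (G : POSG)

theorem aux_reach_pos (hreach : G.ReachPos) (π : G.JointPolicy) (hπ : G.IsJointPolicy π)
    (t : Fin G.T) (hpos : ∀ i (k : Fin G.T), k.1 < t.1 → ∀ x a, 0 < π i k x a)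
    (i : Fin G.n) (x : G.LocTraj i t.1) : 0 < G.reach π i x := by
  let π' : G.JointPolicy := fun j k y a =>
    if k.1 < t.1 then π j k y a else softmax 1 (fun _ => 0) a
  have h1 : G.IsJointPolicy π' := by
    intro j
    refine ⟨fun k y a => ?_, fun k y => ?_⟩
    · by_cases hk : k.1 < t.1
      · simp only [π', if_pos hk]; exact (hπ j).1 k y a
      · simp only [π', if_neg hk]; exact (aux_softmax_pos _ _ _).le
    · by_cases hk : k.1 < t.1
      · simp only [π', if_pos hk]; exact (hπ j).2 k y
      · simp only [π', if_neg hk]; exact aux_softmax_sum _ _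
  have h2 : G.FullyMixed π' := by
    intro j k y a
    by_cases hk : k.1 < t.1
    · simp only [π', if_pos hk]; exact hpos j k hk y a
    · simp only [π', if_neg hk]; exact aux_softmax_pos _ _ _
  have h3 := hreach π' h1 h2 i t x
  rwa [G.aux_reach_congr π π' t.1 (fun j k hk => by funext y a; simp only [π', if_pos hk])] at h3

/-- one-infoset deviation inequality -/
theorem aux_dev (ε : ℝ) (π : G.JointPolicy) (hπ : G.IsJointPolicy π) (hR : G.NashDistR ε π)
    (i : Fin G.n) (t : Fin G.T) (x : G.LocTraj i t.1) (q : G.A → ℝ) (hq0 : ∀ a, 0 ≤ q a)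
    (hq1 : ∑ a, q a = 1) :
    ∑ a, q a * G.advW π i x a - ε * (negEnt q - negEnt (π i t x)) * G.reach π i x ≤ 0 := by
  let p : G.Policy i := Function.update (π i) t (Function.update (π i t) x q)
  have hpx : p t x = q := by simp [p]
  have hpy : ∀ y, y ≠ x → p t y = π i t y := fun y hy => by simp [p, hy]
  have hpk : ∀ k, k ≠ t → p k = π i k := fun k hk => by simp [p, hk]
  have hp : G.IsPolicy p := by
    have key : ∀ k y, (∀ a, 0 ≤ p k y a) ∧ ∑ a, p k y a = 1 := by
      intro k y
      by_cases hk : k = t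
      · subst hk
        by_cases hy : y = x
        · subst hy; rw [hpx]; exact ⟨hq0, hq1⟩
        · rw [hpy y hy]; exact ⟨(hπ i).1 _ _, (hπ i).2 _ _⟩
      · rw [hpk k hk]; exact ⟨(hπ i).1 _ _, (hπ i).2 _ _⟩
    exact ⟨fun k y a => (key k y).1 a, fun k y => (key k y).2⟩
  have hN := hR i p hp
  set π' : G.JointPolicy := Function.update π i p with hπ'def
  have hi : π' i = p := by simp [π']
  have hj : ∀ j, j ≠ i → π' j = π j := fun j hj => by simp [π', hj]
  have hπ' : G.IsJointPolicy π' := by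
    intro j
    by_cases hji : j = i
    · subst hji; rw [hi]; exact hp
    · rw [hj j hji]; exact hπ j
  have hag : ∀ j (k : Fin G.T), k.1 < t.1 → π' j k = π j k := by
    intro j k hk
    by_cases hji : j = i
    · subst hji; rw [hi]; exact hpk k (fun h => by subst h; exact lt_irrefl _ hk)
    · rw [hj j hji]
  have hre : G.reach π' i x = G.reach π i x := G.aux_reach_congr π π' t.1 hag i x
  have hu := G.aux_u_diff π π' hπ' i hj
  have hg : ∑ k ∈ Finset.range G.T, G.γ ^ k * G.auxg π π' i k
      = G.γ ^ t.1 * ∑ a, q a * G.advW π i x a := by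
    rw [Finset.sum_eq_single t.1]
    · congr 1
      unfold auxg advW
      rw [dif_pos t.2]
      simp only [Finset.mul_sum]
      conv_rhs => rw [Finset.sum_comm]
      refine Finset.sum_congr rfl fun h _ => ?_
      rw [G.aux_histProb_congr π π' t.1 hag h, hi]
      by_cases hx : G.red i h = x
      · refine Finset.sum_congr rfl fun a _ => ?_
        rw [if_pos hx, hx]
        change _ * (p t x a * _) = _
        rw [hpx]; ring
      · rw [← Finset.mul_sum]
        change _ * (∑ a, p t (G.red i h) a * _) = _
        rw [hpy _ hx]
        have := G.aux_sumAdv_self π hπ i t.2 h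
        simp only [Fin.eta] at this
        rw [this]
        simp [hx]
    · intro k hk hkt
      have hkT := Finset.mem_range.1 hk
      have : G.auxg π π' i k = 0 := by
        unfold auxg
        rw [dif_pos hkT]
        refine Finset.sum_eq_zero fun h _ => ?_
        rw [hi, hpk ⟨k, hkT⟩ (fun hh => hkt (congrArg Fin.val hh)), G.aux_sumAdv_self π hπ i hkT h,
          mul_zero]
      rw [this, mul_zero]
    · intro hh; exact absurd (Finset.mem_range.2 t.2) hh
  have he : G.entReg ε p π' - G.entReg ε (π i) π'
      = G.γ ^ t.1 * (ε * (negEnt q - negEnt (π i t x)) * G.reach π i x) := by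
    unfold entReg
    rw [← mul_sub, ← Finset.sum_sub_distrib, Finset.sum_eq_single t]
    · rw [← mul_sub, ← Finset.sum_sub_distrib, Finset.sum_eq_single x]
      · rw [hpx, hre]; ring
      · intro y _ hy; rw [hpy y hy, sub_self]
      · intro hh; exact absurd (Finset.mem_univ _) hh
    · intro k _ hk; rw [hpk k hk, sub_self]
    · intro hh; exact absurd (Finset.mem_univ _) hh
  have hfin : G.γ ^ t.1 * (∑ a, q a * G.advW π i x a
      - ε * (negEnt q - negEnt (π i t x)) * G.reach π i x) ≤ 0 := by
    rw [mul_sub, ← hg, ← he, ← hu]; linarith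
  exact nonpos_of_mul_nonpos_right hfin (pow_pos G.γ_pos _)

theorem aux_sum_w (π : G.JointPolicy) (hπ : G.IsJointPolicy π) 
    (i : Fin G.n) (t : Fin G.T) (x : G.LocTraj i t.1) :
    ∑ a, π i t x a * G.advW π i x a = 0 := by
  unfold advW
  simp only [Finset.mul_sum]
  rw [Finset.sum_comm]
  refine Finset.sum_eq_zero fun h _ => ?_
  by_cases hx : G.red i h = x
  · have := G.aux_sumAdv_self π hπ i t.2 h
    simp only [Fin.eta, hx] at this
    simp only [if_pos hx, mul_left_comm _ (G.histProb π t.1 h), ← Finset.mul_sum]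
    rw [this, mul_zero]
  · simp [hx]

theorem aux_main (hreach : G.ReachPos) (ε : ℝ) (hε : 0 < ε)
    (π : G.JointPolicy) (hπ : G.IsJointPolicy π) (hR : G.NashDistR ε π) (m : ℕ) :
    ∀ (t : Fin G.T), t.1 = m → ∀ (i : Fin G.n) (x : G.LocTraj i t.1),
      π i t x = softmax ε (G.w π i t x) := by
  induction m using Nat.strong_induction_on with
  | _ m ih =>
    intro t htm i x
    subst htm
    have hr := G.aux_reach_pos hreach π hπ t (fun j k hk y a => by
      rw [ih k.1 hk k rfl j y]; exact aux_softmax_pos _ _ _) i x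
    have hwe : ∀ a, G.w π i t x a = G.advW π i x a / G.reach π i x := fun _ => rfl
    refine aux_gibbs ε hε _ _ ((hπ i).1 t x) ((hπ i).2 t x) ?_ ?_
    · simp only [hwe, ← mul_div_assoc, ← Finset.sum_div]
      rw [G.aux_sum_w π hπ, zero_div]
    · have hd := G.aux_dev ε π hπ hR i t x (softmax ε (G.w π i t x))
        (fun a => (aux_softmax_pos _ _ _).le) (aux_softmax_sum _ _)
      have e : ∑ a, softmax ε (G.w π i t x) a * G.advW π i x a
          = (∑ a, softmax ε (G.w π i t x) a * G.w π i t x a) * G.reach π i x := by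
        rw [Finset.sum_mul]
        refine Finset.sum_congr rfl fun a _ => ?_
        rw [hwe a]; field_simp
      rw [e, ← sub_mul] at hd
      exact nonpos_of_mul_nonpos_left hd hr

end POSG

/-- **Theorem 1, modification-R case.**  Every Nash distribution `π̄_R` with
modification-R (parameter `ε`) satisfies `σ(w(π̄_R)) = π̄_R`, hence the score
`ȳ_* = w(π̄_R)` is a rest point of the IESL dynamic: `w(σ(ȳ_*)) = ȳ_*`. -/
theorem nashDistR_induces_rest_point (G : POSG) (hreach : G.ReachPos)
    (ε : ℝ) (hε : 0 < ε)
    (πR : G.JointPolicy) (hπR : G.IsJointPolicy πR) (hR : G.NashDistR ε πR) :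
    G.choice ε (G.w πR) = πR ∧ G.w (G.choice ε (G.w πR)) = G.w πR := by
  have h : G.choice ε (G.w πR) = πR := by
    funext i t x a
    exact (congrFun (G.aux_main hreach ε hε πR hπR hR t.1 t rfl i x) a).symm
  exact ⟨h, by rw [h]⟩
end
end

section
/- Lemma 2 (per-information-set optimality of modification-L Nash distributions): Fix ε ≥ 0 and let π̄_L be a Nash distribution with modification-L with parameter ε. Then for every player i, every policy π^i ∈ Π^i, and every information set x_t^i: Σ_{a_t^i} π_L^i(x_t^i, a_t^i) Σ_{h_t ∈ x_t^i} Pr(h_t|π̄_L) A^i_{π̄_L}(h_t, a_t^i) − ε H(π_L^i(x_t^i)) Σ_{h_t ∈ x_t^i} Pr(h_t|π̄_L) ≥ Σ_{a_t^i} π^i(x_t^i, a_t^i) Σ_{h_t ∈ x_t^i} Pr(h_t|π̄_L) A^i_{π̄_L}(h_t, a_t^i) − ε H(π^i(x_t^i)) Σ_{h_t ∈ x_t^i} Pr(h_t|π̄_L). -/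
open scoped Classical BigOperators

noncomputable section

namespace POSG

theorem front_extend (G : POSG) {t : ℕ} (h : G.Hist t) (a : G.JointAct) (s : G.S)
    (z : G.ObsTuple) : G.front (G.extend h a s z) = h := by
  simp [front, extend]

theorem lastState_extend (G : POSG) {t : ℕ} (h : G.Hist t) (a : G.JointAct) (s : G.S)
    (z : G.ObsTuple) : G.lastState (G.extend h a s z) = s := by
  simp [lastState, extend]

theorem extend_front (G : POSG) {t : ℕ} (h : G.Hist (t + 1)) :
    G.extend (G.front h) (h.2.2 (Fin.last t)) (G.lastState h) (h.2.1 (Fin.last (t + 1))) = h := by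
  obtain ⟨h1, h2, h3⟩ := h
  simp only [extend, front, lastState]
  refine Prod.ext ?_ (Prod.ext ?_ ?_)
  · exact Fin.snoc_init_self h1
  · exact Fin.snoc_init_self h2
  · exact Fin.snoc_init_self h3

/-- Histories of length `t+1` are one-step extensions. -/
def histEquiv (G : POSG) (t : ℕ) :
    (G.Hist t × G.JointAct × G.S × G.ObsTuple) ≃ G.Hist (t + 1) where
  toFun q := G.extend q.1 q.2.1 q.2.2.1 q.2.2.2
  invFun h := (G.front h, h.2.2 (Fin.last t), G.lastState h, h.2.1 (Fin.last (t + 1)))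
  left_inv q := by
    obtain ⟨h, a, s, z⟩ := q
    simp only [front_extend, lastState_extend]
    simp [extend]
  right_inv h := G.extend_front h

theorem sum_hist_succ (G : POSG) (t : ℕ) (f : G.Hist (t + 1) → ℝ) :
    ∑ h, f h = ∑ h : G.Hist t, ∑ a : G.JointAct, ∑ s : G.S, ∑ z : G.ObsTuple,
      f (G.extend h a s z) := by
  rw [← Equiv.sum_comp (G.histEquiv t) f]
  simp only [Fintype.sum_prod_type (γ := ℝ)
    (f := fun q : G.Hist t × G.JointAct × G.S × G.ObsTuple => f (G.histEquiv t q))]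
  refine Finset.sum_congr rfl fun h _ => ?_
  rw [Fintype.sum_prod_type]
  refine Finset.sum_congr rfl fun a _ => ?_
  rw [Fintype.sum_prod_type]
  rfl

theorem histProb_extend (G : POSG) (π : G.JointPolicy) {t : ℕ} (h : G.Hist t) (a : G.JointAct)
    (s : G.S) (z : G.ObsTuple) :
    G.histProb π (t + 1) (G.extend h a s z) =
      G.histProb π t h * G.polProb π h a * G.Tr (G.lastState h) a s *
        G.Obs (G.lastState h) a s z := by
  rw [histProb, front_extend, lastState_extend]
  simp [extend]

theorem V_eq (G : POSG) (π : G.JointPolicy) (i : Fin G.n) {t : ℕ} (ht : t < G.T)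
    (h : G.Hist t) :
    G.V π i h = ∑ a : G.JointAct, ∑ s' : G.S, ∑ z' : G.ObsTuple,
          G.polProb π h a * G.Tr (G.lastState h) a s' * G.Obs (G.lastState h) a s' z' *
            (G.R i (G.lastState h) a s' + G.γ * G.V π i (G.extend h a s' z')) := by
  have e : G.T - t = (G.T - (t + 1)) + 1 := by omega
  unfold V
  rw [e, valAux, if_pos ht]

theorem valAux_congr (G : POSG) (π π' : G.JointPolicy) (i : Fin G.n) (t0 : ℕ)
    (H : ∀ t, t0 < t → ∀ (h : G.Hist t) a, G.polProb π' h a = G.polProb π h a) :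
    ∀ (fuel t : ℕ), t0 < t → ∀ h : G.Hist t, G.valAux π' i fuel t h = G.valAux π i fuel t h
  | 0, _, _, _ => rfl
  | fuel + 1, t, ht, h => by
    rw [valAux, valAux]
    split_ifs
    · refine Finset.sum_congr rfl fun a _ => Finset.sum_congr rfl fun s _ =>
        Finset.sum_congr rfl fun z _ => ?_
      rw [H t ht, valAux_congr G π π' i t0 H fuel (t + 1) (by omega)]
    · rfl

/-- Weighted value difference at level `k`. -/
def vdiff (G : POSG) (π π' : G.JointPolicy) (i : Fin G.n) (k : ℕ) : ℝ :=
  ∑ h : G.Hist k, G.histProb π k h * (G.V π' i h - G.V π i h)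

theorem vdiff_step (G : POSG) (π π' : G.JointPolicy) (i : Fin G.n) (k : ℕ) (hk : k < G.T)
    (H : ∀ (h : G.Hist k) a, G.polProb π' h a = G.polProb π h a) :
    G.vdiff π π' i k = G.γ * G.vdiff π π' i (k + 1) := by
  unfold vdiff
  rw [sum_hist_succ, Finset.mul_sum]
  refine Finset.sum_congr rfl fun h _ => ?_
  rw [V_eq G π' i hk, V_eq G π i hk]
  simp only [← Finset.sum_sub_distrib, Finset.mul_sum]
  refine Finset.sum_congr rfl fun a _ => Finset.sum_congr rfl fun s _ =>
        Finset.sum_congr rfl fun z _ => ?_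
  rw [H, histProb_extend]
  ring

theorem vdiff_zero (G : POSG) (π π' : G.JointPolicy) (i : Fin G.n) :
    G.vdiff π π' i 0 = G.u π' i - G.u π i := by
  unfold vdiff u
  simp only [← Finset.sum_sub_distrib]
  rw [← Fintype.sum_prod_type' (f := fun s z => G.ρ s * G.O0 s z * G.V π' i (G.hist0 s z) -
    G.ρ s * G.O0 s z * G.V π i (G.hist0 s z))]
  symm
  refine Finset.sum_bij' (fun q _ => G.hist0 q.1 q.2) (fun h _ => (h.1 0, h.2.1 0))
    (by simp) (by simp) (by simp [hist0]) ?_ ?_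
  · rintro ⟨h1, h2, h3⟩ -
    refine Prod.ext ?_ (Prod.ext ?_ ?_)
    · funext k; simp [hist0, show k = 0 from Fin.ext (by have := k.2; omega)]
    · funext k; simp [hist0, show k = 0 from Fin.ext (by have := k.2; omega)]
    · funext k; exact k.elim0
  · rintro ⟨s, z⟩ -
    simp [histProb, hist0]
    ring

theorem vdiff_iter (G : POSG) (π π' : G.JointPolicy) (i : Fin G.n) (k : ℕ) (hk : k ≤ G.T)
    (H : ∀ t, t < k → ∀ (h : G.Hist t) a, G.polProb π' h a = G.polProb π h a) :
    G.u π' i - G.u π i = G.γ ^ k * G.vdiff π π' i k := by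
  induction k with
  | zero => simp [vdiff_zero]
  | succ k ih =>
    rw [ih (by omega) (fun t ht => H t (by omega)), vdiff_step G π π' i k (by omega)
      (H k (by omega))]
    ring

/-- Deviation of player `i` at the single information set `(t, x)`. -/
def dev (G : POSG) (π : G.JointPolicy) (i : Fin G.n) (t : Fin G.T) (x : G.LocTraj i t.1)
    (r : G.A → ℝ) : G.Policy i :=
  Function.update (π i) t (Function.update (π i t) x r)

theorem V_diff (G : POSG) (π : G.JointPolicy) (i : Fin G.n) (t : Fin G.T)
    (x : G.LocTraj i t.1) (r : G.A → ℝ) (h : G.Hist t.1) :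
    G.V (Function.update π i (G.dev π i t x r)) i h - G.V π i h =
      if G.red i h = x then ∑ b, (r b - π i t x b) * G.Q π i h b else 0 := by
  set π' := Function.update π i (G.dev π i t x r) with hπ'
  have hV : ∀ h' : G.Hist (t.1 + 1), G.V π' i h' = G.V π i h' := by
    intro h'
    refine valAux_congr G π π' i t.1 ?_ _ _ (Nat.lt_succ_self _) _
    intro k hk h a
    unfold polProb
    split_ifs with hkT
    · refine Finset.prod_congr rfl fun j _ => ?_
      by_cases hj : j = i
      · subst hj
        have : (⟨k, hkT⟩ : Fin G.T) ≠ t := fun e => by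
          have := congrArg Fin.val e; simp at this; omega
        simp [hπ', dev, Function.update_of_ne this]
      · simp [hπ', Function.update_of_ne hj]
    · rfl
  have hpol : ∀ (ρ : G.JointPolicy) (a : G.JointAct), G.polProb ρ h a =
      ρ i t (G.red i h) (a i) * ∏ j ∈ Finset.univ.erase i, ρ j t (G.red j h) (a j) := by
    intro ρ a
    rw [polProb, dif_pos t.2, Finset.mul_prod_erase _ (fun j => ρ j t (G.red j h) (a j))
      (Finset.mem_univ i)]
  have hoth : ∀ a : G.JointAct, ∏ j ∈ Finset.univ.erase i, π' j t (G.red j h) (a j) =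
      ∏ j ∈ Finset.univ.erase i, π j t (G.red j h) (a j) := by
    intro a
    refine Finset.prod_congr rfl fun j hj => ?_
    rw [hπ', Function.update_of_ne (Finset.ne_of_mem_erase hj)]
  have hself : ∀ b, π' i t (G.red i h) b = if G.red i h = x then r b else π i t (G.red i h) b := by
    intro b
    simp only [hπ', dev, Function.update_self]
    split_ifs with e
    · rw [e, Function.update_self]
    · rw [Function.update_of_ne e]
  rw [V_eq G π' i t.2, V_eq G π i t.2]
  simp only [hV, hpol, hoth, hself]
  split_ifs with e
  · simp only [Q, dif_pos t.2, Finset.mul_sum, ← Finset.sum_sub_distrib]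
    symm
    rw [Finset.sum_comm]
    refine Finset.sum_congr rfl fun a _ => ?_
    rw [Finset.sum_comm]
    refine Finset.sum_congr rfl fun s _ => ?_
    rw [Finset.sum_comm]
    refine Finset.sum_congr rfl fun z _ => ?_
    rw [Finset.sum_eq_single (a i)]
    · rw [if_pos rfl, e]; ring
    · intro b _ hb
      rw [if_neg (Ne.symm hb)]; ring
    · simp
  · simp

theorem u_diff (G : POSG) (π : G.JointPolicy) (i : Fin G.n) (t : Fin G.T)
    (x : G.LocTraj i t.1) (r : G.A → ℝ) :
    G.u (Function.update π i (G.dev π i t x r)) i - G.u π i =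
      G.γ ^ (t : ℕ) * ∑ h : G.Hist t.1, if G.red i h = x then
        G.histProb π t.1 h * ∑ b, (r b - π i t x b) * G.Q π i h b else 0 := by
  rw [vdiff_iter G π _ i t.1 t.2.le]
  · unfold vdiff
    congr 1
    refine Finset.sum_congr rfl fun h _ => ?_
    rw [V_diff]
    split_ifs <;> simp
  · intro k hk h a
    unfold polProb
    split_ifs with hkT
    · refine Finset.prod_congr rfl fun j _ => ?_
      by_cases hj : j = i
      · subst hj
        have : (⟨k, hkT⟩ : Fin G.T) ≠ t := fun e => by
          have := congrArg Fin.val e; simp at this; omega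
        simp [dev, Function.update_of_ne this]
      · simp [Function.update_of_ne hj]
    · rfl

theorem ent_diff (G : POSG) (ε : ℝ) (π : G.JointPolicy) (i : Fin G.n) (t : Fin G.T)
    (x : G.LocTraj i t.1) (r : G.A → ℝ) :
    G.entReg ε (G.dev π i t x r) π - G.entReg ε (π i) π =
      ε * (G.γ ^ (t : ℕ) * ((negEnt r - negEnt (π i t x)) * G.reach π i x)) := by
  unfold entReg
  rw [← mul_sub, ← Finset.sum_sub_distrib, Finset.sum_eq_single t]
  · rw [← mul_sub, ← Finset.sum_sub_distrib, Finset.sum_eq_single x]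
    · simp only [dev, Function.update_self]; ring
    · intro y _ hy
      simp [dev, Function.update_of_ne hy]
    · simp
  · intro k _ hk
    simp [dev, Function.update_of_ne hk]
  · simp

theorem dev_isPolicy (G : POSG) (π : G.JointPolicy) (hπ : G.IsJointPolicy π) (i : Fin G.n)
    (t : Fin G.T) (x : G.LocTraj i t.1) (r : G.A → ℝ) (h0 : ∀ a, 0 ≤ r a) (h1 : ∑ a, r a = 1) :
    G.IsPolicy (G.dev π i t x r) := by
  have key : ∀ k y, G.dev π i t x r k y = π i k y ∨ G.dev π i t x r k y = r := by
    intro k y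
    by_cases hk : k = t
    · subst hk
      by_cases hy : y = x
      · subst hy; right; simp [dev]
      · left; simp [dev, Function.update_of_ne hy]
    · left; simp [dev, Function.update_of_ne hk]
  refine ⟨fun k y a => ?_, fun k y => ?_⟩
  · rcases key k y with e | e <;> rw [e]
    · exact (hπ i).1 k y a
    · exact h0 a
  · rcases key k y with e | e <;> rw [e]
    · exact (hπ i).2 k y
    · exact h1

theorem adv_diff (G : POSG) (π : G.JointPolicy) (i : Fin G.n) (t : Fin G.T)
    (x : G.LocTraj i t.1) (r : G.A → ℝ) (hr : ∑ a, r a = 1) (hq : ∑ a, π i t x a = 1) :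
    (∑ a, r a * G.advW π i x a) - ∑ a, π i t x a * G.advW π i x a =
      ∑ h : G.Hist t.1, if G.red i h = x then
        G.histProb π t.1 h * ∑ b, (r b - π i t x b) * G.Q π i h b else 0 := by
  rw [← Finset.sum_sub_distrib]
  simp only [← sub_mul]
  simp only [advW, Finset.mul_sum]
  rw [Finset.sum_comm]
  refine Finset.sum_congr rfl fun h _ => ?_
  split_ifs
  · have : ∑ b, (r b - π i t x b) = 0 := by rw [Finset.sum_sub_distrib, hr, hq, sub_self]
    have h2 : ∑ b, (r b - π i t x b) * (G.histProb π t.1 h * G.V π i h) = 0 := by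
      rw [← Finset.sum_mul, this, zero_mul]
    rw [← sub_eq_zero, ← Finset.sum_sub_distrib, ← neg_eq_zero, ← Finset.sum_neg_distrib, ← h2]
    refine Finset.sum_congr rfl fun b _ => ?_
    unfold Adv; ring
  · simp

end POSG

/-- **Lemma 2 (per-information-set optimality of modification-L Nash distributions).**
For every player `i`, policy `π^i`, and information set `x_t^i`:
`∑_a π_L^i(x,a) ∑_{h∈x} Pr(h|π̄_L) A^i_{π̄_L}(h,a) − ε H(π_L^i(x)) ∑_{h∈x} Pr(h|π̄_L)
 ≥ ∑_a π^i(x,a) ∑_{h∈x} Pr(h|π̄_L) A^i_{π̄_L}(h,a) − ε H(π^i(x)) ∑_{h∈x} Pr(h|π̄_L)`. -/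
theorem nashDistL_per_infoset_optimality (G : POSG) (ε : ℝ) (hε : 0 ≤ ε)
    (πL : G.JointPolicy) (hπL : G.IsJointPolicy πL) (hL : G.NashDistL ε πL)
    (i : Fin G.n) (p : G.Policy i) (hp : G.IsPolicy p)
    (t : Fin G.T) (x : G.LocTraj i t.1) :
    (∑ a : G.A, πL i t x a * G.advW πL i x a) -
        ε * negEnt (πL i t x) * G.reach πL i x ≥
      (∑ a : G.A, p t x a * G.advW πL i x a) -
        ε * negEnt (p t x) * G.reach πL i x := by
  have h1 := hL i (G.dev πL i t x (p t x))
    (G.dev_isPolicy πL hπL i t x (p t x) (hp.1 t x) (hp.2 t x))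
  have h2 := G.u_diff πL i t x (p t x)
  have h3 := G.ent_diff ε πL i t x (p t x)
  have h4 := G.adv_diff πL i t x (p t x) (hp.2 t x) ((hπL i).2 t x)
  rw [← h4] at h2
  have hγ : 0 < G.γ ^ (t : ℕ) := pow_pos G.γ_pos _
  have h5 : G.γ ^ (t : ℕ) * (((∑ a, p t x a * G.advW πL i x a) -
      ∑ a, πL i t x a * G.advW πL i x a) -
      ε * ((negEnt (p t x) - negEnt (πL i t x)) * G.reach πL i x)) ≤ 0 := by
    rw [mul_sub, ← h2]
    linarith
  have h6 := nonpos_of_mul_nonpos_right h5 hγ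
  linarith
end
end
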